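/- arXiv:2011.13002 — 4 statements merged into one kernel-verified Lean document; each statement's English description precedes it below -/
import Mathlib

section
/- Let p be a prime and k ≥ 1 an integer; write N = p^{k+1}. Identify each x ∈ Fin N with the pair (i, j) where i = x / p^k ∈ Fin p and j = x mod p^k ∈ Fin (p^k). Let W ⊆ Perm(Fin N) be the set of permutations π for which there exists τ ∈ Perm(Fin p) such that (π x) / p^k = τ(x / p^k) for all x ∈ Fin N (i.e. π permutes the p consecutive blocks of size p^k; W is the wreath product Σ_p ≀ Σ_{p^k} as a subset of Σ_{p^{k+1}}). Let σ₀ ∈ Perm(Fin N) be the permutation sending the element with decomposition i·p^k + j (0 ≤ i < p, 0 ≤ j < p^k) to j·p + i. Then the subgroup of Perm(Fin N) generated by W ∪ {σ₀} is the whole symmetric group Perm(Fin N). -/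
/-- The block index of `x ∈ Fin (p^{k+1})`: the quotient `x / p^k`, an element of `Fin p`. -/
def blockIdx (p k : ℕ) [hp : Fact p.Prime] (x : Fin (p ^ (k + 1))) : Fin p :=
  ⟨(x : ℕ) / p ^ k, by
    have hx : (x : ℕ) < p * p ^ k := by
      rw [← pow_succ']
      exact x.isLt
    exact (Nat.div_lt_iff_lt_mul (Nat.pow_pos hp.out.pos)).mpr hx⟩

theorem blockDecomp_lt₁ (p k : ℕ) [hp : Fact p.Prime] (i : Fin p) (j : Fin (p ^ k)) :
    (i : ℕ) * p ^ k + (j : ℕ) < p ^ (k + 1) := by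
  have hi : (i : ℕ) + 1 ≤ p := i.isLt
  have hj : (j : ℕ) < p ^ k := j.isLt
  calc (i : ℕ) * p ^ k + (j : ℕ) < (i : ℕ) * p ^ k + p ^ k := Nat.add_lt_add_left hj _
    _ = ((i : ℕ) + 1) * p ^ k := by ring
    _ ≤ p * p ^ k := Nat.mul_le_mul_right _ hi
    _ = p ^ (k + 1) := by rw [pow_succ, Nat.mul_comm]

theorem blockDecomp_lt₂ (p k : ℕ) [hp : Fact p.Prime] (i : Fin p) (j : Fin (p ^ k)) :
    (j : ℕ) * p + (i : ℕ) < p ^ (k + 1) := by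
  have hi : (i : ℕ) < p := i.isLt
  have hj : (j : ℕ) + 1 ≤ p ^ k := j.isLt
  calc (j : ℕ) * p + (i : ℕ) < (j : ℕ) * p + p := Nat.add_lt_add_left hi _
    _ = ((j : ℕ) + 1) * p := by ring
    _ ≤ p ^ k * p := Nat.mul_le_mul_right _ hj
    _ = p ^ (k + 1) := (pow_succ p k).symm

/-- A subgroup of permutations containing the swaps of a fixed point with every other point
is the whole symmetric group. -/
theorem Equiv.Perm.subgroup_eq_top_of_forall_swap_mem {α : Type*} [DecidableEq α] [Finite α]
    (G : Subgroup (Equiv.Perm α)) (a : α) (h : ∀ x, Equiv.swap x a ∈ G) : G = ⊤ := by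
  rw [eq_top_iff, ← Equiv.Perm.closure_isSwap, Subgroup.closure_le]
  rintro _ ⟨x, y, -, rfl⟩
  refine SubmonoidClass.swap_mem_trans (b := a) G (h x) ?_
  rw [Equiv.swap_comm]
  exact h y

/-- A swap of two points in the same block preserves every block. -/
theorem blockIdx_swap_apply (p k : ℕ) [Fact p.Prime] {x y : Fin (p ^ (k + 1))}
    (h : blockIdx p k x = blockIdx p k y) (z : Fin (p ^ (k + 1))) :
    blockIdx p k (Equiv.swap x y z) = blockIdx p k z := by
  rw [Equiv.swap_apply_def]
  split_ifs with h₁ h₂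
  · rw [h₁, h]
  · rw [h₂, h]
  · rfl

/-- The wreath product `Σ_p ≀ Σ_{p^k}` (the permutations of `Fin (p^{k+1})` permuting the `p`
consecutive blocks of size `p^k`) together with the block transposition
`σ₀ : i·p^k + j ↦ j·p + i` generate the full symmetric group on `p^{k+1}` letters. -/
theorem wreath_and_blockTranspose_generate_symmetricGroup
    (p k : ℕ) [hp : Fact p.Prime] (hk : 1 ≤ k)
    (W : Set (Equiv.Perm (Fin (p ^ (k + 1)))))
    (hW : W = {π | ∃ τ : Equiv.Perm (Fin p),
      ∀ x : Fin (p ^ (k + 1)), blockIdx p k (π x) = τ (blockIdx p k x)})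
    (σ₀ : Equiv.Perm (Fin (p ^ (k + 1))))
    (hσ₀ : ∀ (i : Fin p) (j : Fin (p ^ k)),
      σ₀ ⟨(i : ℕ) * p ^ k + (j : ℕ), blockDecomp_lt₁ p k i j⟩ =
        ⟨(j : ℕ) * p + (i : ℕ), blockDecomp_lt₂ p k i j⟩) :
    Subgroup.closure (W ∪ {σ₀}) = ⊤ := by
  obtain ⟨m, rfl⟩ : ∃ m, k = m + 1 := ⟨k - 1, by omega⟩
  have hpos : 0 < p := hp.out.pos
  have hsame : ∀ x y, blockIdx p (m + 1) x = blockIdx p (m + 1) y →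
      Equiv.swap x y ∈ Subgroup.closure (W ∪ {σ₀}) := by
    intro x y h
    refine Subgroup.subset_closure (Or.inl ?_)
    rw [hW]
    exact ⟨1, blockIdx_swap_apply p (m + 1) h⟩
  have hσ : σ₀ ∈ Subgroup.closure (W ∪ {σ₀}) := Subgroup.subset_closure (Or.inr rfl)
  let i₀ : Fin p := ⟨0, hpos⟩
  let j₀ : Fin (p ^ (m + 1)) := ⟨0, by positivity⟩
  let f : Fin (p ^ (m + 1)) → Fin (p ^ (m + 1 + 1)) := fun j ↦
    ⟨(i₀ : ℕ) * p ^ (m + 1) + (j : ℕ), blockDecomp_lt₁ p (m + 1) i₀ j⟩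
  have hf : ∀ j j', blockIdx p (m + 1) (f j) = blockIdx p (m + 1) (f j') := fun j j' ↦
    Fin.ext <| by simp [blockIdx, f, i₀, Nat.div_eq_of_lt j.isLt, Nat.div_eq_of_lt j'.isLt]
  refine Equiv.Perm.subgroup_eq_top_of_forall_swap_mem _ (σ₀ (f j₀)) fun x ↦ ?_
  -- The image of the first block under `σ₀` meets the block of `x` in its first element.
  have hj : (blockIdx p (m + 1) x : ℕ) * p ^ m < p ^ (m + 1) := by
    rw [pow_succ']
    exact Nat.mul_lt_mul_of_pos_right (blockIdx p (m + 1) x).isLt (by positivity)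
  let j : Fin (p ^ (m + 1)) := ⟨_, hj⟩
  have hx : blockIdx p (m + 1) x = blockIdx p (m + 1) (σ₀ (f j)) := by
    rw [hσ₀]
    apply Fin.ext
    change _ = ((blockIdx p (m + 1) x : ℕ) * p ^ m * p + 0) / p ^ (m + 1)
    rw [add_zero, mul_assoc, ← pow_succ, Nat.mul_div_cancel _ (by positivity)]
  refine SubmonoidClass.swap_mem_trans _ (hsame _ _ hx) ?_
  rw [Equiv.swap_apply_apply]
  exact mul_mem (mul_mem hσ (hsame _ _ (hf j j₀))) (inv_mem hσ)
end

section
/- Let p be a prime, s ≥ 1 an integer, K = GaloisField p s, and φ : K → K the Frobenius map x ↦ x^p. Let ω ∈ K be an element such that (ω, ω^p, ω^{p^2}, …, ω^{p^{s−1}}) is a basis of K as a (ZMod p)-vector space (a normal element). Let N be a (ZMod p)-module and d : N ≃ N a (ZMod p)-linear automorphism satisfying d^s = id. Then the (ZMod p)-linear map N → K ⊗_{ZMod p} N defined by x ↦ Σ_{i=0}^{s−1} ω^{p^i} ⊗ d^i(x) is injective, and its image is exactly the set of fixed points {v ∈ K ⊗_{ZMod p} N : (φ ⊗ d)(v) =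 v} of the induced endomorphism φ ⊗ d of K ⊗_{ZMod p} N. -/
open TensorProduct

/-- Coordinates of a tensor with respect to a finite basis of the left factor are unique. -/
theorem sum_tmul_basis_injective {R M N ι : Type*} [CommRing R] [Fintype ι]
    [AddCommGroup M] [Module R M] [AddCommGroup N] [Module R N] (b : Module.Basis ι R M) :
    Function.Injective (fun c : ι → N => ∑ i, b i ⊗ₜ[R] c i) := by
  classical
  intro c c' h
  have key := (TensorProduct.equivFinsuppOfBasisLeft (N := N) b).symm.injective
    (a₁ := Finsupp.equivFunOnFinite.symm c) (a₂ := Finsupp.equivFunOnFinite.symm c') (by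
      simpa [TensorProduct.equivFinsuppOfBasisLeft_symm_apply, Finsupp.sum_fintype] using h)
  exact Finsupp.equivFunOnFinite.symm.injective key

/-- If an endomorphism `f` of `M` permutes a basis cyclically and `d ^ s = 1`, then a vector of
`M ⊗ N` is fixed by `f ⊗ d` if and only if its coordinates are `d ^ i x` for some `x`. -/
theorem range_sum_basis_tmul_pow_eq_fixedPoints {R M N : Type*} [CommRing R]
    [AddCommGroup M] [Module R M] [AddCommGroup N] [Module R N] {s : ℕ} [NeZero s]
    (b : Module.Basis (Fin s) R M) (f : M →ₗ[R] M) (hf : ∀ i, f (b i) = b (i + 1))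
    (d : N ≃ₗ[R] N) (hd : d ^ s = 1) :
    Set.range (fun x : N => ∑ i : Fin s, b i ⊗ₜ[R] ((d ^ (i : ℕ)) x)) =
      {v : M ⊗[R] N | TensorProduct.map f d.toLinearMap v = v} := by
  have map_sum_basis (c : Fin s → N) : TensorProduct.map f d.toLinearMap (∑ i, b i ⊗ₜ[R] c i) =
      ∑ i, b (i + 1) ⊗ₜ[R] d (c i) := by
    simp [hf]
  have d_pow (i : Fin s) (x : N) : d ((d ^ (i : ℕ)) x) = (d ^ ((i + 1 : Fin s) : ℕ)) x := by
    rw [Fin.val_add, Fin.val_one', Nat.add_mod_mod, ← pow_eq_pow_mod _ hd, pow_succ',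
      LinearEquiv.mul_apply]
  ext v
  constructor
  · rintro ⟨x, rfl⟩
    simp only [Set.mem_ofPred_eq, map_sum_basis, d_pow]
    exact Equiv.sum_comp (Equiv.addRight (1 : Fin s)) fun i => b i ⊗ₜ[R] ((d ^ (i : ℕ)) x)
  · intro hv
    obtain ⟨c, rfl⟩ := (TensorProduct.equivFinsuppOfBasisLeft b).symm.surjective v
    rw [TensorProduct.equivFinsuppOfBasisLeft_symm_apply, Finsupp.sum_fintype _ _ (by simp)]
      at hv ⊢
    rw [Set.mem_ofPred_eq, map_sum_basis] at hv
    have hv' : ∑ i, b (i + 1) ⊗ₜ[R] d (c i) = ∑ i, b (i + 1) ⊗ₜ[R] c (i + 1) :=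
      hv.trans (Equiv.sum_comp (Equiv.addRight (1 : Fin s)) fun i => b i ⊗ₜ[R] c i).symm
    have hc (i : Fin s) : c (i + 1) = d (c i) :=
      (congrFun (sum_tmul_basis_injective
        (b.reindex (Equiv.addRight (1 : Fin s)).symm) (by simpa using hv')) i).symm
    have hpow (n : ℕ) : c (Fin.ofNat s n) = (d ^ n) (c 0) := by
      induction n with
      | zero => simp
      | succ n ih =>
        rw [pow_succ', LinearEquiv.mul_apply, ← ih, ← hc]
        congr 1
        ext
        simp [Fin.val_add]
    refine ⟨c 0, Finset.sum_congr rfl fun i _ => ?_⟩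
    rw [← hpow, Fin.ofNat_val_eq_self]

/-- For a normal element `ω` of `F_{p^s}` over `F_p` and an order-`s` automorphism `d` of a
`(ZMod p)`-module `N`, the map `x ↦ Σ_{i<s} ω^{p^i} ⊗ d^i x` is injective with image the
fixed points of `φ ⊗ d` on `F_{p^s} ⊗ N`, where `φ` is the Frobenius. -/
theorem fixedPoints_of_twisted_frobenius
    (p s : ℕ) [Fact p.Prime] (hs : 1 ≤ s)
    (N : Type) [AddCommGroup N] [Module (ZMod p) N]
    (d : N ≃ₗ[ZMod p] N) (hd : d ^ s = 1)
    (φ : GaloisField p s →ₗ[ZMod p] GaloisField p s) (hφ : ∀ x, φ x = x ^ p)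
    (ω : GaloisField p s) (bω : Module.Basis (Fin s) (ZMod p) (GaloisField p s))
    (hbω : ∀ i : Fin s, bω i = ω ^ p ^ (i : ℕ)) :
    Function.Injective
      (fun x : N => ∑ i : Fin s, (ω ^ p ^ (i : ℕ)) ⊗ₜ[ZMod p] ((d ^ (i : ℕ)) x)) ∧
    Set.range
      (fun x : N => ∑ i : Fin s, (ω ^ p ^ (i : ℕ)) ⊗ₜ[ZMod p] ((d ^ (i : ℕ)) x)) =
      {v : GaloisField p s ⊗[ZMod p] N | TensorProduct.map φ d.toLinearMap v = v} := by
  have : NeZero s := ⟨by omega⟩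
  have hω : ω ^ p ^ s = ω := by
    have : Fintype (GaloisField p s) := Fintype.ofFinite _
    rw [← GaloisField.card p s (by omega), Nat.card_eq_fintype_card, FiniteField.pow_card]
  have hφb (i : Fin s) : φ (bω i) = bω (i + 1) := by
    rw [hφ, hbω, hbω, ← pow_mul, ← pow_succ, Fin.val_add, Fin.val_one', Nat.add_mod_mod]
    obtain h | h : (i : ℕ) + 1 < s ∨ (i : ℕ) + 1 = s := by omega
    · rw [Nat.mod_eq_of_lt h]
    · rw [h, Nat.mod_self, pow_zero, pow_one, hω]
  simp only [← hbω]
  refine ⟨fun x y hxy => ?_, range_sum_basis_tmul_pow_eq_fixedPoints bω φ hφb d hd⟩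
  simpa using congrFun (sum_tmul_basis_injective bω hxy) 0
end

section
/- Let R be a commutative ring, σ a type, and A = R[X_s : s ∈ σ] the multivariate polynomial ring. Let d : A → A be an R-derivation of A (an R-linear map with d(f·g) = f·d(g) + g·d(f)). Then there exists a unique sequence D : ℕ → (A →ₗ[R] A) of R-linear endomorphisms of A such that: (1) D_0 = id; (2) D_1 = d; (3) D_n(f·g) = Σ_{i+j=n} D_i(f)·D_j(g) for all f, g ∈ A and all n ∈ ℕ; and (4) D_n(X_s) = 0 for every s ∈ σ and every n ≥ 2. -/
open MvPolynomial

namespace HigherDerivation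

variable {R A : Type*} [CommRing R] [CommRing A] [Algebra R A]

/-- The generating series `f ↦ ∑ D_n(f) Tⁿ` of a sequence of linear endomorphisms. -/
noncomputable def genSeries (D : ℕ → A →ₗ[R] A) : A →ₗ[R] PowerSeries A where
  toFun f := PowerSeries.mk fun n => D n f
  map_add' f g := by ext n; simp
  map_smul' r f := by
    ext n
    simp [LinearMap.map_smul_of_tower]

@[simp]
theorem coeff_genSeries (D : ℕ → A →ₗ[R] A) (n : ℕ) (f : A) :
    PowerSeries.coeff n (genSeries D f) = D n f :=
  PowerSeries.coeff_mk n fun n => D n f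

variable {D : ℕ → A →ₗ[R] A}

theorem genSeries_mul
    (hmul : ∀ (n : ℕ) (f g : A),
      D n (f * g) = ∑ ij ∈ Finset.HasAntidiagonal.antidiagonal n, D ij.1 f * D ij.2 g)
    (f g : A) : genSeries D (f * g) = genSeries D f * genSeries D g := by
  ext n
  simp [PowerSeries.coeff_mul, hmul]

theorem genSeries_one (h_zero : D 0 = LinearMap.id)
    (hmul : ∀ (n : ℕ) (f g : A),
      D n (f * g) = ∑ ij ∈ Finset.HasAntidiagonal.antidiagonal n, D ij.1 f * D ij.2 g) :
    genSeries D 1 = 1 := by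
  have hunit : IsUnit (genSeries D 1) := by
    rw [PowerSeries.isUnit_iff_constantCoeff, ← PowerSeries.coeff_zero_eq_constantCoeff_apply]
    simp [h_zero]
  refine hunit.mul_left_cancel ?_
  rw [← genSeries_mul hmul, mul_one, mul_one]

/-- The generating series of a higher derivation is an algebra homomorphism. -/
noncomputable def toAlgHom (D : ℕ → A →ₗ[R] A) (h_zero : D 0 = LinearMap.id)
    (hmul : ∀ (n : ℕ) (f g : A),
      D n (f * g) = ∑ ij ∈ Finset.HasAntidiagonal.antidiagonal n, D ij.1 f * D ij.2 g) :
    A →ₐ[R] PowerSeries A :=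
  AlgHom.ofLinearMap (genSeries D) (genSeries_one h_zero hmul) (genSeries_mul hmul)

@[simp]
theorem coeff_toAlgHom (h_zero : D 0 = LinearMap.id)
    (hmul : ∀ (n : ℕ) (f g : A),
      D n (f * g) = ∑ ij ∈ Finset.HasAntidiagonal.antidiagonal n, D ij.1 f * D ij.2 g)
    (n : ℕ) (f : A) : PowerSeries.coeff n (toAlgHom D h_zero hmul f) = D n f :=
  coeff_genSeries D n f

/-- A higher derivation of a polynomial ring is determined by its values on the variables. -/
theorem ext_of_X {σ : Type*} {D E : ℕ → MvPolynomial σ R →ₗ[R] MvPolynomial σ R}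
    (hD_zero : D 0 = LinearMap.id)
    (hD_mul : ∀ (n : ℕ) (f g : MvPolynomial σ R),
      D n (f * g) = ∑ ij ∈ Finset.HasAntidiagonal.antidiagonal n, D ij.1 f * D ij.2 g)
    (hE_zero : E 0 = LinearMap.id)
    (hE_mul : ∀ (n : ℕ) (f g : MvPolynomial σ R),
      E n (f * g) = ∑ ij ∈ Finset.HasAntidiagonal.antidiagonal n, E ij.1 f * E ij.2 g)
    (h : ∀ n s, D n (X s) = E n (X s)) : D = E := by
  have key : toAlgHom D hD_zero hD_mul = toAlgHom E hE_zero hE_mul :=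
    MvPolynomial.algHom_ext fun s => by
      ext1 n
      simpa using h n s
  funext n
  refine LinearMap.ext fun f => ?_
  simpa using congrArg (PowerSeries.coeff n) (DFunLike.congr_fun key f)

end HigherDerivation

namespace Derivation

variable {R σ : Type*} [CommRing R] (d : Derivation R (MvPolynomial σ R) (MvPolynomial σ R))

/-- The algebra homomorphism sending `X_s` to `X_s + d(X_s) T`. -/
noncomputable def unstableAlgHom : MvPolynomial σ R →ₐ[R] PowerSeries (MvPolynomial σ R) :=
  aeval fun s => PowerSeries.C (X s) + PowerSeries.C (d (X s)) * PowerSeries.X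

/-- The higher derivation extending `d` whose terms of index at least `2` vanish on variables. -/
noncomputable def unstableExtension (n : ℕ) : MvPolynomial σ R →ₗ[R] MvPolynomial σ R :=
  (PowerSeries.coeff n).restrictScalars R ∘ₗ d.unstableAlgHom.toLinearMap

theorem unstableExtension_apply (n : ℕ) (f : MvPolynomial σ R) :
    d.unstableExtension n f = PowerSeries.coeff n (d.unstableAlgHom f) :=
  rfl

theorem unstableExtension_X (n : ℕ) (s : σ) :
    d.unstableExtension n (X s) =
      (if n = 0 then X s else 0) + if n = 1 then d (X s) else 0 := by
  simp [unstableExtension_apply, unstableAlgHom, PowerSeries.coeff_C, PowerSeries.coeff_X]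

theorem unstableExtension_C (n : ℕ) (r : R) :
    d.unstableExtension n (C r) = if n = 0 then C r else 0 := by
  simp [unstableExtension_apply, unstableAlgHom, PowerSeries.algebraMap_apply,
    PowerSeries.coeff_C, MvPolynomial.algebraMap_eq]

theorem unstableExtension_mul (n : ℕ) (f g : MvPolynomial σ R) :
    d.unstableExtension n (f * g) = ∑ ij ∈ Finset.HasAntidiagonal.antidiagonal n,
      d.unstableExtension ij.1 f * d.unstableExtension ij.2 g := by
  simp only [unstableExtension_apply, map_mul, PowerSeries.coeff_mul]

theorem unstableExtension_zero : d.unstableExtension 0 = LinearMap.id := by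
  refine LinearMap.ext fun f => ?_
  induction f using MvPolynomial.induction_on with
  | C r => simp [unstableExtension_C]
  | add p q hp hq => rw [map_add, hp, hq, map_add]
  | mul_X p s hp => simp [unstableExtension_mul, hp, unstableExtension_X]

theorem unstableExtension_one (f : MvPolynomial σ R) : d.unstableExtension 1 f = d f := by
  induction f using MvPolynomial.induction_on with
  | C r => simp [unstableExtension_C]
  | add p q hp hq => rw [map_add, hp, hq, map_add]
  | mul_X p s hp =>
    simp [unstableExtension_mul, Finset.Nat.antidiagonal_succ, hp, unstableExtension_X,
      unstableExtension_zero, mul_comm]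

end Derivation

/-- Any `R`-derivation `d` of the polynomial ring `R[X_s : s ∈ σ]` extends uniquely to a
higher derivation `D = (D_n)` with `D_0 = id`, `D_1 = d`, and `D_n(X_s) = 0` for `n ≥ 2`. -/
theorem derivation_extends_uniquely_to_unstable_higher_derivation
    (R : Type) [CommRing R] (σ : Type)
    (d : Derivation R (MvPolynomial σ R) (MvPolynomial σ R)) :
    ∃! D : ℕ → (MvPolynomial σ R →ₗ[R] MvPolynomial σ R),
      D 0 = LinearMap.id ∧
      (∀ f : MvPolynomial σ R, D 1 f = d f) ∧
      (∀ (n : ℕ) (f g : MvPolynomial σ R),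
        D n (f * g) = ∑ ij ∈ Finset.HasAntidiagonal.antidiagonal n, D ij.1 f * D ij.2 g) ∧
      (∀ (s : σ) (n : ℕ), 2 ≤ n → D n (X s) = 0) := by
  refine ⟨d.unstableExtension, ⟨d.unstableExtension_zero, d.unstableExtension_one,
    d.unstableExtension_mul, fun s n hn => ?_⟩, ?_⟩
  · rw [d.unstableExtension_X, if_neg (by omega), if_neg (by omega), add_zero]
  · rintro D ⟨h_zero, h_one, hmul, h_unstable⟩
    refine HigherDerivation.ext_of_X h_zero hmul d.unstableExtension_zero
      d.unstableExtension_mul fun n s => ?_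
    rw [d.unstableExtension_X]
    match n with
    | 0 => simp [h_zero]
    | 1 => simp [h_one]
    | n + 2 => simp [h_unstable]
end

section
/- Let p be a prime, σ a type, and A = (ZMod p)[X_s : s ∈ σ]. Let m : σ → (σ →₀ ZMod p) be a family of finitely supported coefficient functions, and for each s ∈ σ set v_s = Σ_t m(s)(t)·X_t ∈ A. Let D : ℕ → (A →ₗ A) be any sequence of (ZMod p)-linear endomorphisms of A such that: (1) D_0 = id; (2) D_1(X_s) = (v_s)^p for all s ∈ σ; (3) D_n(f·g) = Σ_{i+j=n} D_i(f)·D_j(g) for all f, g ∈ A and all n ∈ ℕ; and (4) D_n(X_s) = 0 for every s ∈ σ and every n ≥ 2. Then for every i with 1 ≤ i ≤ p−1, one has D_i ∘ D_1 = (i+1)·D_{i+1}. -/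
open MvPolynomial

/-- The power series `∑ D_n(f) tⁿ` attached to a sequence of linear endomorphisms satisfying the
Leibniz rules of a higher derivation, as an algebra homomorphism. -/
noncomputable def higherDerivationSeries {R A : Type*} [CommRing R] [CommRing A] [IsDomain A]
    [Algebra R A] (D : ℕ → (A →ₗ[R] A)) (h0 : D 0 = LinearMap.id)
    (hmul : ∀ (n : ℕ) (f g : A),
      D n (f * g) = ∑ ij ∈ Finset.HasAntidiagonal.antidiagonal n, D ij.1 f * D ij.2 g) :
    A →ₐ[R] PowerSeries A :=
  have mul (f g : A) : PowerSeries.mk (fun n => D n (f * g)) =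
      PowerSeries.mk (fun n => D n f) * PowerSeries.mk (fun n => D n g) := by
    ext n
    simp [PowerSeries.coeff_mul, hmul]
  AlgHom.ofLinearMap
    { toFun := fun f => PowerSeries.mk fun n => D n f
      map_add' := fun f g => by ext n; simp
      map_smul' := fun c f => by ext n; simp }
    (by
      have hne : PowerSeries.mk (fun n => D n (1 : A)) ≠ 0 := fun h => by
        simpa [h0] using congrArg (PowerSeries.coeff 0) h
      exact mul_left_cancel₀ hne (by simpa using (mul 1 1).symm))
    mul

theorem coeff_higherDerivationSeries {R A : Type*} [CommRing R] [CommRing A] [IsDomain A]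
    [Algebra R A] (D : ℕ → (A →ₗ[R] A)) (h0 : D 0 = LinearMap.id)
    (hmul : ∀ (n : ℕ) (f g : A),
      D n (f * g) = ∑ ij ∈ Finset.HasAntidiagonal.antidiagonal n, D ij.1 f * D ij.2 g)
    (n : ℕ) (f : A) :
    PowerSeries.coeff n (higherDerivationSeries D h0 hmul f) = D n f := by
  simp [higherDerivationSeries]

theorem PowerSeries.coeff_mul_congr_of_lt {A : Type*} [CommSemiring A] {N : ℕ}
    {a a' : PowerSeries A} (b : PowerSeries A)
    (h : ∀ n < N, PowerSeries.coeff n a = PowerSeries.coeff n a') {n : ℕ} (hn : n < N) :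
    PowerSeries.coeff n (a * b) = PowerSeries.coeff n (a' * b) := by
  rw [PowerSeries.coeff_mul, PowerSeries.coeff_mul]
  refine Finset.sum_congr rfl fun ij hij => ?_
  rw [h ij.1 ((Finset.HasAntidiagonal.antidiagonal.fst_le hij).trans_lt hn)]

theorem PowerSeries.coeff_pow_char_eq_zero {A : Type*} [CommRing A] [IsDomain A] (p : ℕ)
    [CharP A p] (g : PowerSeries A) {n : ℕ} (hn : 0 < n) (hnp : n < p) :
    PowerSeries.coeff n (g ^ p) = 0 := by
  obtain ⟨k, rfl⟩ := Nat.exists_eq_add_of_lt hn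
  rw [zero_add] at hnp ⊢
  have hp : (p : PowerSeries A) = 0 := by
    rw [← map_natCast (PowerSeries.C (R := A)), CharP.cast_eq_zero, map_zero]
  have h : PowerSeries.derivative A (g ^ p) = 0 := by
    rw [Derivation.leibniz_pow, ← Nat.cast_smul_eq_nsmul (PowerSeries A), hp, zero_smul]
  have hk := congrArg (PowerSeries.coeff k) h
  rw [PowerSeries.coeff_derivative, map_zero] at hk
  refine (mul_eq_zero.mp hk).resolve_right fun hz => ?_
  have : p ∣ k + 1 := (CharP.cast_eq_zero_iff A p (k + 1)).mp (by exact_mod_cast hz)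
  exact absurd (Nat.le_of_dvd k.succ_pos this) (by omega)



/-- The unstable higher derivation on `(ZMod p)[X_s : s ∈ σ]` determined on generators by
`D_1(X_s) = (Σ_t m(s)(t)·X_t)^p` satisfies `D_i D_1 = (i+1) D_{i+1}` for `1 ≤ i ≤ p−1`. -/
theorem twisted_higher_derivation_iterate_relation
    (p : ℕ) [Fact p.Prime] (σ : Type)
    (m : σ → (σ →₀ ZMod p))
    (D : ℕ → (MvPolynomial σ (ZMod p) →ₗ[ZMod p] MvPolynomial σ (ZMod p)))
    (h0 : D 0 = LinearMap.id)
    (h1 : ∀ s : σ, D 1 (X s) = ((m s).sum fun t c => C c * X t) ^ p)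
    (hmul : ∀ (n : ℕ) (f g : MvPolynomial σ (ZMod p)),
      D n (f * g) = ∑ ij ∈ Finset.HasAntidiagonal.antidiagonal n, D ij.1 f * D ij.2 g)
    (hX : ∀ (s : σ) (n : ℕ), 2 ≤ n → D n (X s) = 0) :
    ∀ i : ℕ, 1 ≤ i → i ≤ p - 1 → D i ∘ₗ D 1 = (i + 1) • D (i + 1) := by
  set F := higherDerivationSeries D h0 hmul
  have hc (n : ℕ) (f : MvPolynomial σ (ZMod p)) : PowerSeries.coeff n (F f) = D n f :=
    coeff_higherDerivationSeries D h0 hmul n f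
  have hD1 (f g : MvPolynomial σ (ZMod p)) : D 1 (f * g) = f * D 1 g + D 1 f * g := by
    simp [hmul, h0, Finset.Nat.antidiagonal_succ]
  have hsucc (n : ℕ) (f : MvPolynomial σ (ZMod p)) :
      PowerSeries.coeff n (PowerSeries.derivative _ (F f)) = (n + 1) • D (n + 1) f := by
    rw [PowerSeries.coeff_derivative, hc, nsmul_eq_mul, mul_comm]
    push_cast
    rfl
  have key (f : MvPolynomial σ (ZMod p)) : ∀ n < p, PowerSeries.coeff n (F (D 1 f)) =
      PowerSeries.coeff n (PowerSeries.derivative _ (F f)) := by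
    have hX' (s : σ) : ∀ n < p, PowerSeries.coeff n (F (D 1 (X s))) =
        PowerSeries.coeff n (PowerSeries.derivative _ (F (X s))) := by
      rintro (_ | n) hn
      · rw [hsucc, hc, h0]
        simp
      · rw [hsucc, hX s (n + 1 + 1) (by omega), smul_zero, h1, map_pow]
        exact PowerSeries.coeff_pow_char_eq_zero p _ n.succ_pos hn
    induction f using MvPolynomial.induction_on with
    | C c =>
      have hFC : F (C c) = algebraMap (ZMod p) _ c := F.commutes c
      have hDC (n : ℕ) : D (n + 1) (C c) = 0 := by
        rw [← hc, hFC, PowerSeries.algebraMap_apply, PowerSeries.coeff_C, if_neg n.succ_ne_zero]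
      intro n _
      rw [hsucc, hDC n, hDC 0, map_zero, map_zero, smul_zero]
    | add f g hf hg =>
      intro n hn
      simp only [map_add, hf n hn, hg n hn]
    | mul_X f s hf =>
      intro n hn
      rw [hD1, map_add, map_mul, map_mul, map_mul, Derivation.leibniz, smul_eq_mul, smul_eq_mul,
        map_add, map_add, mul_comm (F f), mul_comm (F f), mul_comm (F (X s)),
        PowerSeries.coeff_mul_congr_of_lt _ (hX' s) hn,
        PowerSeries.coeff_mul_congr_of_lt _ hf hn]
  intro i _ hip
  refine LinearMap.ext fun f => ?_
  rw [LinearMap.comp_apply, LinearMap.smul_apply, ← hsucc, ← hc]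
  exact key f i (by omega)
end
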